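/- Let μ₁ and μ₂ be Borel probability measures on ℝⁿ with finite first moments (∫‖x‖ dμᵢ(x) < ∞ for i = 1,2) such that μ₁ ⪯ μ₂ in convex order. Then there exists a Markov kernel K from ℝⁿ to ℝⁿ such that (i) for μ₁-almost every x, the measure K x has finite first moment and barycenter x, i.e. ∫ y d(K x)(y) = x, and (ii) μ₁.bind K = μ₂. -/

import Mathlib

open MeasureTheory ProbabilityTheory

namespace StrassenAux
open Filter Topology

/-- Shorthand for Euclidean space. -/
abbrev Eu (n : ℕ) := EuclideanSpace ℝ (Fin n)

/-- Functions of at most linear growth. -/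
def linGrowth (n : ℕ) : Submodule ℝ (Eu n × Eu n → ℝ) where
  carrier := {φ | ∃ C : ℝ, ∀ z, |φ z| ≤ C * (1 + ‖z.1‖ + ‖z.2‖)}
  zero_mem' := ⟨0, by simp⟩
  add_mem' := by
    rintro f g ⟨C, hC⟩ ⟨D, hD⟩
    refine ⟨C + D, fun z => ?_⟩
    have := abs_add_le (f z) (g z)
    have h1 := hC z
    have h2 := hD z
    simp only [Pi.add_apply]
    linarith
  smul_mem' := by
    rintro c f ⟨C, hC⟩
    refine ⟨|c| * C, fun z => ?_⟩
    simp only [Pi.smul_apply, smul_eq_mul, abs_mul, mul_assoc]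
    exact mul_le_mul_of_nonneg_left (hC z) (abs_nonneg c)

/-- Values of the dual problem for the majorants of `φ`. -/
def dualVals {n : ℕ} (μ₁ μ₂ : Measure (Eu n)) (φ : Eu n × Eu n → ℝ) : Set ℝ :=
  {r | ∃ (a : Eu n → ℝ) (b : Eu n → Eu n) (g : Eu n → ℝ), Integrable a μ₁ ∧ Integrable g μ₂ ∧
    (∀ x y, φ (x, y) ≤ a x + inner ℝ (b x) (y - x) + g y) ∧ r = ∫ x, a x ∂μ₁ + ∫ y, g y ∂μ₂}

variable {n : ℕ} {μ₁ μ₂ : Measure (Eu n)}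

lemma dualVals_zero [IsProbabilityMeasure μ₁] [IsProbabilityMeasure μ₂]
    (hmom₂ : Integrable (fun x => ‖x‖) μ₂)
    (hconv : ∀ f : Eu n → ℝ, ConvexOn ℝ Set.univ f → Integrable f μ₂ →
      Integrable f μ₁ ∧ (∫ x, f x ∂μ₁) ≤ ∫ x, f x ∂μ₂) {r : ℝ}
    (hr : r ∈ dualVals μ₁ μ₂ 0) : 0 ≤ r := by
  obtain ⟨a, b, g, ha, hg, h, rfl⟩ := hr
  set F : Eu n → ℝ := fun y => ⨆ x, (-(a x) - inner ℝ (b x) (y - x)) with hF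
  have hle : ∀ y x, -(a x) - inner ℝ (b x) (y - x) ≤ g y := fun y x => by
    have := h x y
    simp only [Pi.zero_apply] at this
    linarith
  have hbdd : ∀ y, BddAbove (Set.range fun x => (-(a x) - inner ℝ (b x) (y - x))) := fun y =>
    ⟨g y, by rintro _ ⟨x, rfl⟩; exact hle y x⟩
  have hFg : ∀ y, F y ≤ g y := fun y => ciSup_le (hle y)
  have hlF : ∀ y x, -(a x) - inner ℝ (b x) (y - x) ≤ F y := fun y x => le_ciSup (hbdd y) x
  have hcx : ConvexOn ℝ Set.univ F := by
    refine ⟨convex_univ, fun y _ z _ s t hs ht hst => ?_⟩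
    refine ciSup_le fun x => ?_
    have h1 := mul_le_mul_of_nonneg_left (hlF y x) hs
    have h2 := mul_le_mul_of_nonneg_left (hlF z x) ht
    have h3 : s • y + t • z - x = s • (y - x) + t • (z - x) := by
      have : x = (s + t) • x := by rw [hst, one_smul]
      nth_rewrite 1 [this]
      module
    rw [h3, inner_add_right, inner_smul_right, inner_smul_right]
    have h4 : a x = s * a x + t * a x := by rw [← add_mul, hst, one_mul]
    simp only [smul_eq_mul]
    linarith
  have hcont : Continuous F := by
    rw [← continuousOn_univ]
    exact hcx.continuousOn isOpen_univ
  have hint : Integrable F μ₂ := by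
    refine Integrable.mono' (g := fun y => |g y| + (|a 0| + ‖b 0‖ * ‖y‖)) ?_
      hcont.aestronglyMeasurable (Eventually.of_forall fun y => ?_)
    · exact hg.abs.add ((integrable_const _).add (hmom₂.const_mul _))
    · have h1 := hlF y 0
      have h2 := hFg y
      have h3 := real_inner_le_norm (b 0) (y - 0)
      rw [sub_zero] at h1 h3
      rw [Real.norm_eq_abs, abs_le]
      have := le_abs_self (g y)
      have := abs_nonneg (g y)
      have := le_abs_self (a 0)
      have := abs_nonneg (a 0)
      have := mul_nonneg (norm_nonneg (b 0)) (norm_nonneg y)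
      constructor <;> linarith
  obtain ⟨hi1, hi2⟩ := hconv F hcx hint
  have h1 : ∫ y, F y ∂μ₂ ≤ ∫ y, g y ∂μ₂ := integral_mono hint hg hFg
  have h2 : ∫ x, -a x ∂μ₁ ≤ ∫ x, F x ∂μ₁ := integral_mono ha.neg hi1 fun x => by
    simpa using hlF x x
  rw [integral_neg] at h2
  linarith

lemma dualVals_add {φ ψ : Eu n × Eu n → ℝ} {r s : ℝ} (hr : r ∈ dualVals μ₁ μ₂ φ)
    (hs : s ∈ dualVals μ₁ μ₂ ψ) : r + s ∈ dualVals μ₁ μ₂ (φ + ψ) := by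
  obtain ⟨a, b, g, ha, hg, h, rfl⟩ := hr
  obtain ⟨a', b', g', ha', hg', h', rfl⟩ := hs
  refine ⟨fun x => a x + a' x, fun x => b x + b' x, fun x => g x + g' x, ha.add ha', hg.add hg',
    fun x y => ?_, ?_⟩
  · have := h x y
    have := h' x y
    simp only [inner_add_left, Pi.add_apply]
    linarith
  · rw [integral_add ha ha', integral_add hg hg']
    ring

lemma dualVals_smul {φ : Eu n × Eu n → ℝ} {r c : ℝ} (hc : 0 ≤ c) (hr : r ∈ dualVals μ₁ μ₂ φ) :
    c * r ∈ dualVals μ₁ μ₂ (c • φ) := by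
  obtain ⟨a, b, g, ha, hg, h, rfl⟩ := hr
  refine ⟨fun x => c * a x, fun x => c • b x, fun x => c * g x, ha.const_mul c, hg.const_mul c,
    fun x y => ?_, ?_⟩
  · have := mul_le_mul_of_nonneg_left (h x y) hc
    simp only [real_inner_smul_left, Pi.smul_apply, smul_eq_mul]
    linarith
  · rw [integral_const_mul, integral_const_mul]
    ring

lemma dualVals_nonempty [IsProbabilityMeasure μ₁] [IsProbabilityMeasure μ₂]
    (hmom₁ : Integrable (fun x => ‖x‖) μ₁) (hmom₂ : Integrable (fun x => ‖x‖) μ₂)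
    (φ : linGrowth n) : (dualVals μ₁ μ₂ φ).Nonempty := by
  obtain ⟨φ, C, hC⟩ := φ
  refine ⟨_, fun x => C * (1 + ‖x‖), fun _ => 0, fun y => C * ‖y‖,
    ((integrable_const _).add hmom₁).const_mul C, hmom₂.const_mul C, fun x y => ?_, rfl⟩
  have := (le_abs_self _).trans (hC (x, y))
  simp only [inner_zero_left]
  linarith

lemma exists_functional [IsProbabilityMeasure μ₁] [IsProbabilityMeasure μ₂]
    (hmom₁ : Integrable (fun x => ‖x‖) μ₁) (hmom₂ : Integrable (fun x => ‖x‖) μ₂)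
    (hconv : ∀ f : Eu n → ℝ, ConvexOn ℝ Set.univ f → Integrable f μ₂ →
      Integrable f μ₁ ∧ (∫ x, f x ∂μ₁) ≤ ∫ x, f x ∂μ₂) :
    ∃ L : linGrowth n →ₗ[ℝ] ℝ, ∀ φ : linGrowth n, ∀ r ∈ dualVals μ₁ μ₂ φ, L φ ≤ r := by
  have hne := dualVals_nonempty hmom₁ hmom₂
  have hbdd : ∀ φ : linGrowth n, BddBelow (dualVals μ₁ μ₂ φ) := fun φ => by
    obtain ⟨s, hs⟩ := hne (-φ)
    refine ⟨-s, fun r hr => ?_⟩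
    have := dualVals_add hr hs
    simp only [Submodule.coe_neg, add_neg_cancel] at this
    have := dualVals_zero hmom₂ hconv this
    linarith
  let p : linGrowth n → ℝ := fun φ => sInf (dualVals μ₁ μ₂ φ)
  have hple : ∀ c : ℝ, 0 < c → ∀ φ, p (c • φ) ≤ c * p φ := fun c hc φ => by
    rw [← div_le_iff₀' hc]
    refine le_csInf (hne φ) fun r hr => ?_
    rw [div_le_iff₀' hc]
    exact csInf_le (hbdd _) (dualVals_smul hc.le hr)
  obtain ⟨L, -, hL⟩ := exists_extension_of_le_sublinear ⟨⊥, 0⟩ p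
    (fun c hc φ => by
      refine le_antisymm (hple c hc φ) ?_
      have := hple c⁻¹ (inv_pos.2 hc) (c • φ)
      rw [smul_smul, inv_mul_cancel₀ hc.ne', one_smul] at this
      rwa [← le_inv_mul_iff₀ hc])
    (fun φ ψ => by
      rw [← sub_le_iff_le_add]
      refine le_csInf (hne φ) fun r hr => ?_
      rw [sub_le_iff_le_add, ← sub_le_iff_le_add']
      refine le_csInf (hne ψ) fun s hs => ?_
      rw [sub_le_iff_le_add']
      exact csInf_le (hbdd _) (dualVals_add hr hs))
    (by
      rintro ⟨x, hx⟩
      have hx0 : x = 0 := (Submodule.mem_bot ℝ).1 hx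
      subst hx0
      change (0 : ℝ) ≤ p 0
      exact le_csInf (hne _) fun r hr => dualVals_zero hmom₂ hconv hr)
  exact ⟨L, fun φ r hr => (hL φ).trans (csInf_le (hbdd φ) hr)⟩

/-- A continuous cutoff function. -/
noncomputable def cutoff (R : ℕ) (z : Eu n × Eu n) : ℝ := max 0 (min 1 (R + 1 - ‖z‖))

lemma cutoff_continuous (R : ℕ) : Continuous (cutoff (n := n) R) := by
  unfold cutoff
  fun_prop

lemma cutoff_nonneg (R : ℕ) (z : Eu n × Eu n) : 0 ≤ cutoff R z := le_max_left _ _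

lemma cutoff_le_one (R : ℕ) (z : Eu n × Eu n) : cutoff R z ≤ 1 :=
  max_le zero_le_one (min_le_left _ _)

lemma cutoff_eq_one (R : ℕ) (z : Eu n × Eu n) (h : ‖z‖ ≤ R) : cutoff R z = 1 := by
  unfold cutoff
  rw [min_eq_left (by linarith), max_eq_right zero_le_one]

lemma cutoff_compact (R : ℕ) : HasCompactSupport (cutoff (n := n) R) := by
  refine HasCompactSupport.intro (isCompact_closedBall (0 : Eu n × Eu n) (R + 1)) fun z hz => ?_
  rw [mem_closedBall_zero_iff, not_le] at hz
  unfold cutoff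
  rw [max_eq_left]
  exact (min_le_right _ _).trans (by linarith)

lemma cutoff_tendsto (z : Eu n × Eu n) : Tendsto (fun R : ℕ => cutoff R z) atTop (𝓝 1) := by
  refine tendsto_const_nhds.congr' ?_
  obtain ⟨N, hN⟩ := exists_nat_ge ‖z‖
  filter_upwards [eventually_ge_atTop N] with R hR
  exact (cutoff_eq_one R z (hN.trans (by exact_mod_cast hR))).symm

/-- Tail of the norm. -/
noncomputable def tail (R : ℕ) (x : Eu n) : ℝ := {x : Eu n | (R : ℝ) ≤ ‖x‖}.indicator (fun x => ‖x‖) x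

lemma tail_nonneg (R : ℕ) (x : Eu n) : 0 ≤ tail R x :=
  Set.indicator_nonneg (fun _ _ => norm_nonneg _) x

lemma tail_measurableSet (R : ℕ) : MeasurableSet {x : Eu n | (R : ℝ) ≤ ‖x‖} :=
  measurableSet_le measurable_const measurable_norm

lemma tail_integrable (R : ℕ) {μ : Measure (Eu n)} (h : Integrable (fun x => ‖x‖) μ) :
    Integrable (tail R) μ := h.indicator (tail_measurableSet R)

lemma tail_tendsto {μ : Measure (Eu n)} (h : Integrable (fun x => ‖x‖) μ) :
    Tendsto (fun R : ℕ => ∫ x, tail R x ∂μ) atTop (𝓝 0) := by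
  have := tendsto_integral_of_dominated_convergence (μ := μ) (F := fun R : ℕ => tail (n := n) R)
    (f := fun _ => (0 : ℝ)) (fun x => ‖x‖) (fun R => (tail_integrable R h).aestronglyMeasurable) h
    (fun R => Eventually.of_forall fun x => ?_) (Eventually.of_forall fun x => ?_)
  · simpa using this
  · rw [Real.norm_of_nonneg (tail_nonneg R x)]
    exact Set.indicator_le_self' (fun _ _ => norm_nonneg _) x
  · refine tendsto_const_nhds.congr' ?_
    obtain ⟨N, hN⟩ := exists_nat_gt ‖x‖
    filter_upwards [eventually_ge_atTop N] with R hR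
    have h1 : (N : ℝ) ≤ R := by exact_mod_cast hR
    have h2 : ¬ ((R : ℝ) ≤ ‖x‖) := by linarith
    simp [tail, h2]

lemma one_sub_cutoff_le {R : ℕ} (hR : 1 ≤ R) (x y : Eu n) :
    (1 - cutoff R (x, y)) * (1 + ‖x‖ + ‖y‖) ≤ 3 * tail R x + 3 * tail R y := by
  have hR' : (1 : ℝ) ≤ R := by exact_mod_cast hR
  have t1 := tail_nonneg R x
  have t2 := tail_nonneg R y
  have h0 := cutoff_nonneg R (x, y)
  have hx := norm_nonneg x
  have hy := norm_nonneg y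
  by_cases h : ‖(x, y)‖ ≤ R
  · rw [cutoff_eq_one R _ h]
    linarith
  · rw [Prod.norm_mk, not_le] at h
    have h1 : (1 - cutoff R (x, y)) * (1 + ‖x‖ + ‖y‖) ≤ 1 * (1 + ‖x‖ + ‖y‖) :=
      mul_le_mul_of_nonneg_right (by linarith) (by linarith)
    refine h1.trans ?_
    rcases le_total ‖x‖ ‖y‖ with hxy | hxy
    · rw [max_eq_right hxy] at h
      have : tail R y = ‖y‖ := Set.indicator_of_mem (s := {x : Eu n | (R : ℝ) ≤ ‖x‖}) h.le _
      linarith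
    · rw [max_eq_left hxy] at h
      have : tail R x = ‖x‖ := Set.indicator_of_mem (s := {x : Eu n | (R : ℝ) ≤ ‖x‖}) h.le _
      linarith

lemma cutoff_mul_mem (R : ℕ) (f : linGrowth n) :
    (fun z => cutoff R z * (f : Eu n × Eu n → ℝ) z) ∈ linGrowth n := by
  obtain ⟨f, C, hC⟩ := f
  refine ⟨C, fun z => ?_⟩
  rw [abs_mul, abs_of_nonneg (cutoff_nonneg R z)]
  exact (mul_le_of_le_one_left (abs_nonneg _) (cutoff_le_one R z)).trans (hC z)

lemma functional_cutoff_tendsto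
    (hmom₁ : Integrable (fun x => ‖x‖) μ₁) (hmom₂ : Integrable (fun x => ‖x‖) μ₂)
    (L : linGrowth n →ₗ[ℝ] ℝ) (hL : ∀ φ : linGrowth n, ∀ r ∈ dualVals μ₁ μ₂ φ, L φ ≤ r)
    (f : linGrowth n) :
    Tendsto (fun R : ℕ => L ⟨_, cutoff_mul_mem R f⟩) atTop (𝓝 (L f)) := by
  obtain ⟨C, hC⟩ := f.2
  have hC0 : 0 ≤ C := by
    have := (abs_nonneg _).trans (hC 0)
    simpa using this
  have hlim : Tendsto (fun R : ℕ => ∫ x, C * (3 * tail R x) ∂μ₁ + ∫ x, C * (3 * tail R x) ∂μ₂)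
      atTop (𝓝 0) := by
    simp only [integral_const_mul]
    simpa using (((tail_tendsto hmom₁).const_mul 3).const_mul C).add
      (((tail_tendsto hmom₂).const_mul 3).const_mul C)
  rw [tendsto_iff_dist_tendsto_zero]
  refine squeeze_zero' (Eventually.of_forall fun _ => dist_nonneg) ?_ hlim
  filter_upwards [eventually_ge_atTop 1] with R hR
  have key : ∀ x y : Eu n, |(1 - cutoff R (x, y)) * (f : Eu n × Eu n → ℝ) (x, y)| ≤
      C * (3 * tail R x) + C * (3 * tail R y) := fun x y => by
    have h1 : 0 ≤ 1 - cutoff R (x, y) := sub_nonneg.2 (cutoff_le_one R _)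
    rw [abs_mul, abs_of_nonneg h1]
    have h2 := mul_le_mul_of_nonneg_left (hC (x, y)) h1
    have h3 := mul_le_mul_of_nonneg_left (one_sub_cutoff_le hR x y) hC0
    simp only at h2
    linarith
  have i1 := ((tail_integrable R hmom₁).const_mul 3).const_mul C
  have i2 := ((tail_integrable R hmom₂).const_mul 3).const_mul C
  rw [Real.dist_eq, abs_le, ← map_sub]
  constructor
  · have := hL (f - ⟨_, cutoff_mul_mem R f⟩) _ ⟨_, fun _ => 0, _, i1, i2, fun x y => ?_, rfl⟩
    · rw [map_sub] at this ⊢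
      linarith
    · have := (le_abs_self _).trans (key x y)
      simp only [Submodule.coe_sub, Pi.sub_apply, inner_zero_left]
      linarith
  · refine hL _ _ ⟨_, fun _ => 0, _, i1, i2, fun x y => ?_, rfl⟩
    have := (neg_le_abs _).trans (key x y)
    simp only [Submodule.coe_sub, Pi.sub_apply, inner_zero_left]
    linarith

lemma functional_nonneg [IsProbabilityMeasure μ₁] [IsProbabilityMeasure μ₂]
    (L : linGrowth n →ₗ[ℝ] ℝ) (hL : ∀ φ : linGrowth n, ∀ r ∈ dualVals μ₁ μ₂ φ, L φ ≤ r)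
    (f : linGrowth n) (hf : ∀ z, 0 ≤ (f : Eu n × Eu n → ℝ) z) : 0 ≤ L f := by
  have := hL (-f) 0 ⟨fun _ => 0, fun _ => 0, fun _ => 0, integrable_zero _ _ _,
    integrable_zero _ _ _, fun x y => ?_, by simp⟩
  · rw [map_neg] at this
    linarith
  · simpa using hf (x, y)

lemma compactlySupported_mem (f : CompactlySupportedContinuousMap (Eu n × Eu n) ℝ) :
    (f : Eu n × Eu n → ℝ) ∈ linGrowth n := by
  obtain ⟨C, hC⟩ := f.continuous.bounded_above_of_compact_support f.hasCompactSupport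
  refine ⟨C, fun z => (hC z).trans ?_⟩
  have h0 : 0 ≤ C := (norm_nonneg _).trans (hC 0)
  have h1 := norm_nonneg z.1
  have h2 := norm_nonneg z.2
  exact le_mul_of_one_le_right h0 (by linarith)

lemma exists_representation [IsProbabilityMeasure μ₁] [IsProbabilityMeasure μ₂]
    (hmom₁ : Integrable (fun x => ‖x‖) μ₁) (hmom₂ : Integrable (fun x => ‖x‖) μ₂)
    (L : linGrowth n →ₗ[ℝ] ℝ) (hL : ∀ φ : linGrowth n, ∀ r ∈ dualVals μ₁ μ₂ φ, L φ ≤ r) :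
    ∃ π : Measure (Eu n × Eu n), ∀ f : linGrowth n, Continuous (f : Eu n × Eu n → ℝ) →
      Integrable (f : Eu n × Eu n → ℝ) π ∧ ∫ z, (f : Eu n × Eu n → ℝ) z ∂π = L f := by
  let Λ₀ : CompactlySupportedContinuousMap (Eu n × Eu n) ℝ →ₗ[ℝ] ℝ :=
    { toFun := fun f => L ⟨f, compactlySupported_mem f⟩
      map_add' := fun f g => by rw [← map_add]; rfl
      map_smul' := fun c f => by rw [← map_smul]; rfl }
  let Λ := PositiveLinearMap.mk₀ Λ₀ (fun f hf => functional_nonneg L hL _ hf)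
  let π := RealRMK.rieszMeasure Λ
  have hcut : ∀ (f : linGrowth n), Continuous (f : Eu n × Eu n → ℝ) → ∀ R : ℕ,
      Integrable (fun z => cutoff R z * (f : Eu n × Eu n → ℝ) z) π ∧
      ∫ z, cutoff R z * (f : Eu n × Eu n → ℝ) z ∂π = L ⟨_, cutoff_mul_mem R f⟩ := by
    intro f hf R
    let F : CompactlySupportedContinuousMap (Eu n × Eu n) ℝ :=
      ⟨⟨fun z => cutoff R z * (f : Eu n × Eu n → ℝ) z, (cutoff_continuous R).mul hf⟩,
        (cutoff_compact R).mul_right⟩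
    exact ⟨F.continuous.integrable_of_hasCompactSupport F.hasCompactSupport,
      RealRMK.integral_rieszMeasure Λ F⟩
  have hlim := functional_cutoff_tendsto hmom₁ hmom₂ L hL
  have hint : ∀ f : linGrowth n, Continuous (f : Eu n × Eu n → ℝ) →
      (∀ z, 0 ≤ (f : Eu n × Eu n → ℝ) z) → Integrable (f : Eu n × Eu n → ℝ) π := by
    intro f hf hf0
    refine ⟨hf.aestronglyMeasurable, ?_⟩
    rw [hasFiniteIntegral_iff_ofReal (Eventually.of_forall hf0)]
    have h1 : ∫⁻ z, ENNReal.ofReal ((f : Eu n × Eu n → ℝ) z) ∂π ≤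
        liminf (fun R : ℕ => ∫⁻ z, ENNReal.ofReal (cutoff R z * (f : Eu n × Eu n → ℝ) z) ∂π)
          atTop := by
      refine le_trans (lintegral_mono fun z => ?_) (lintegral_liminf_le fun R => ?_)
      · refine le_of_eq (Tendsto.liminf_eq ?_).symm
        refine (ENNReal.continuous_ofReal.tendsto _).comp ?_
        simpa using (cutoff_tendsto z).mul_const ((f : Eu n × Eu n → ℝ) z)
      · exact (ENNReal.continuous_ofReal.comp ((cutoff_continuous R).mul hf)).measurable
    refine h1.trans_lt ?_
    have h2 : ∀ R : ℕ, ∫⁻ z, ENNReal.ofReal (cutoff R z * (f : Eu n × Eu n → ℝ) z) ∂π =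
        ENNReal.ofReal (L ⟨_, cutoff_mul_mem R f⟩) := fun R => by
      rw [← (hcut f hf R).2, ofReal_integral_eq_lintegral_ofReal (hcut f hf R).1]
      exact Eventually.of_forall fun z => mul_nonneg (cutoff_nonneg R z) (hf0 z)
    simp only [h2]
    exact (((ENNReal.continuous_ofReal.tendsto _).comp (hlim f)).liminf_eq).trans_lt
      ENNReal.ofReal_lt_top
  refine ⟨π, fun f hf => ?_⟩
  have habs : Integrable (fun z => |(f : Eu n × Eu n → ℝ) z|) π := by
    refine hint ⟨fun z => |(f : Eu n × Eu n → ℝ) z|, ?_⟩ hf.abs fun z => abs_nonneg _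
    obtain ⟨C, hC⟩ := f.2
    exact ⟨C, fun z => by rw [abs_abs]; exact hC z⟩
  refine ⟨habs.mono' hf.aestronglyMeasurable (Eventually.of_forall fun z => le_rfl), ?_⟩
  have h1 := tendsto_integral_of_dominated_convergence (μ := π)
    (F := fun (R : ℕ) z => cutoff R z * (f : Eu n × Eu n → ℝ) z) (f := (f : Eu n × Eu n → ℝ))
    (fun z => |(f : Eu n × Eu n → ℝ) z|) (fun R => (hcut f hf R).1.aestronglyMeasurable) habs
    (fun R => Eventually.of_forall fun z => ?_) (Eventually.of_forall fun z => ?_)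
  · simp only [(hcut f hf _).2] at h1
    exact tendsto_nhds_unique h1 (hlim f)
  · rw [norm_mul, Real.norm_of_nonneg (cutoff_nonneg R z)]
    exact mul_le_of_le_one_left (norm_nonneg _) (cutoff_le_one R z)
  · simpa using (cutoff_tendsto z).mul_const ((f : Eu n × Eu n → ℝ) z)

lemma exists_coupling [IsProbabilityMeasure μ₁] [IsProbabilityMeasure μ₂]
    (hmom₁ : Integrable (fun x => ‖x‖) μ₁) (hmom₂ : Integrable (fun x => ‖x‖) μ₂)
    (hconv : ∀ f : Eu n → ℝ, ConvexOn ℝ Set.univ f → Integrable f μ₂ →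
      Integrable f μ₁ ∧ (∫ x, f x ∂μ₁) ≤ ∫ x, f x ∂μ₂) :
    ∃ π : Measure (Eu n × Eu n), IsProbabilityMeasure π ∧ π.fst = μ₁ ∧ π.snd = μ₂ ∧
      ∀ h : Eu n → ℝ, Continuous h → (∃ C, ∀ x, |h x| ≤ C) → ∀ c : Eu n,
        ∫ z, h z.1 * inner ℝ c (z.2 - z.1) ∂π = 0 := by
  obtain ⟨L, hL⟩ := exists_functional hmom₁ hmom₂ hconv
  obtain ⟨π, hπ⟩ := exists_representation hmom₁ hmom₂ L hL
  -- values of `L` are determined by two-sided bounds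
  have hb : ∀ (f : Eu n × Eu n → ℝ), Continuous f → (∃ C, ∀ z, |f z| ≤ C) → f ∈ linGrowth n := by
    rintro f hf ⟨C, hC⟩
    refine ⟨C, fun z => (hC z).trans ?_⟩
    have h0 : 0 ≤ C := (abs_nonneg _).trans (hC 0)
    have h1 := norm_nonneg z.1
    have h2 := norm_nonneg z.2
    exact le_mul_of_one_le_right h0 (by linarith)
  have hval : ∀ (f : linGrowth n) (r : ℝ), Continuous (f : Eu n × Eu n → ℝ) →
      r ∈ dualVals μ₁ μ₂ f → -r ∈ dualVals μ₁ μ₂ (-f : linGrowth n) →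
      ∫ z, (f : Eu n × Eu n → ℝ) z ∂π = r := by
    intro f r hf h1 h2
    rw [(hπ f hf).2]
    have h3 := hL _ _ h1
    have h4 := hL _ _ h2
    rw [map_neg] at h4
    linarith
  have hf1 : ∀ h : Eu n → ℝ, Continuous h → (∃ C, ∀ x, |h x| ≤ C) →
      ∫ z, h z.1 ∂π = ∫ x, h x ∂μ₁ := by
    rintro h hc ⟨C, hC⟩
    have hi : Integrable h μ₁ := Integrable.of_bound hc.aestronglyMeasurable C
      (Eventually.of_forall hC)
    refine hval ⟨fun z => h z.1, hb _ (by fun_prop) ⟨C, fun z => hC z.1⟩⟩ _ (hc.comp continuous_fst) ?_ ?_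
    · exact ⟨h, fun _ => 0, fun _ => 0, hi, integrable_zero _ _ _, by simp, by simp⟩
    · exact ⟨fun x => - h x, fun _ => 0, fun _ => 0, hi.neg, integrable_zero _ _ _, by simp,
        by simp [integral_neg]⟩
  have hf2 : ∀ h : Eu n → ℝ, Continuous h → (∃ C, ∀ x, |h x| ≤ C) →
      ∫ z, h z.2 ∂π = ∫ x, h x ∂μ₂ := by
    rintro h hc ⟨C, hC⟩
    have hi : Integrable h μ₂ := Integrable.of_bound hc.aestronglyMeasurable C
      (Eventually.of_forall hC)
    refine hval ⟨fun z => h z.2, hb _ (by fun_prop) ⟨C, fun z => hC z.2⟩⟩ _ (hc.comp continuous_snd) ?_ ?_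
    · exact ⟨fun _ => 0, fun _ => 0, h, integrable_zero _ _ _, hi, by simp, by simp⟩
    · exact ⟨fun _ => 0, fun _ => 0, fun x => - h x, integrable_zero _ _ _, hi.neg, by simp,
        by simp [integral_neg]⟩
  have hfin : IsFiniteMeasure π := by
    have := (hπ ⟨fun _ => 1, hb _ continuous_const ⟨1, by simp⟩⟩ continuous_const).1
    simpa [integrable_const_iff, isFiniteMeasure_iff] using this
  have hfst : π.fst = μ₁ := by
    refine ext_of_forall_integral_eq_of_IsFiniteMeasure fun f => ?_
    rw [Measure.fst, integral_map measurable_fst.aemeasurable f.continuous.aestronglyMeasurable]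
    exact hf1 f f.continuous ⟨‖f‖, fun x => f.norm_coe_le_norm x⟩
  have hsnd : π.snd = μ₂ := by
    refine ext_of_forall_integral_eq_of_IsFiniteMeasure fun f => ?_
    rw [Measure.snd, integral_map measurable_snd.aemeasurable f.continuous.aestronglyMeasurable]
    exact hf2 f f.continuous ⟨‖f‖, fun x => f.norm_coe_le_norm x⟩
  refine ⟨π, ⟨?_⟩, hfst, hsnd, ?_⟩
  · rw [← Measure.fst_univ, hfst, measure_univ]
  · rintro h hc ⟨C, hC⟩ c
    have hmem : (fun z : Eu n × Eu n => h z.1 * inner ℝ c (z.2 - z.1)) ∈ linGrowth n := by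
      refine ⟨C * ‖c‖, fun z => ?_⟩
      have hC0 : 0 ≤ C := (abs_nonneg _).trans (hC 0)
      rw [abs_mul, mul_assoc]
      refine mul_le_mul (hC _) ((abs_real_inner_le_norm _ _).trans ?_) (abs_nonneg _) hC0
      refine mul_le_mul_of_nonneg_left ?_ (norm_nonneg _)
      have := norm_sub_le z.2 z.1
      linarith
    have hcont : Continuous (fun z : Eu n × Eu n => h z.1 * inner ℝ c (z.2 - z.1)) := by fun_prop
    refine hval ⟨_, hmem⟩ 0 hcont ?_ ?_
    · exact ⟨fun _ => 0, fun x => h x • c, fun _ => 0, integrable_zero _ _ _, integrable_zero _ _ _,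
        fun x y => by simp [real_inner_smul_left], by simp⟩
    · exact ⟨fun _ => 0, fun x => -(h x • c), fun _ => 0, integrable_zero _ _ _,
        integrable_zero _ _ _, fun x y => by simp [real_inner_smul_left], by simp⟩

end StrassenAux

/-- Theorem 1, Property 1 ⇒ Property 2, Strassen over ℝⁿ.
If `μ₁ ⪯ μ₂` in convex order (both with finite first moments), then there exists a
Markov kernel `K` with barycenter `x` at `μ₁`-a.e. `x` and with `μ₁.bind K = μ₂`. -/
theorem strassen_convex_order_implies_kernel (n : ℕ)
    (μ₁ μ₂ : Measure (EuclideanSpace ℝ (Fin n)))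
    [IsProbabilityMeasure μ₁] [IsProbabilityMeasure μ₂]
    (hmom₁ : Integrable (fun x => ‖x‖) μ₁)
    (hmom₂ : Integrable (fun x => ‖x‖) μ₂)
    (hconv : ∀ f : EuclideanSpace ℝ (Fin n) → ℝ, ConvexOn ℝ Set.univ f → Integrable f μ₂ →
      Integrable f μ₁ ∧ (∫ x, f x ∂μ₁) ≤ ∫ x, f x ∂μ₂) :
    ∃ K : Kernel (EuclideanSpace ℝ (Fin n)) (EuclideanSpace ℝ (Fin n)),
      IsMarkovKernel K ∧
      (∀ᵐ x ∂μ₁, Integrable (fun y => y) (K x) ∧ (∫ y, y ∂(K x)) = x) ∧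
      μ₁.bind (fun x => K x) = μ₂ := by
  obtain ⟨π, hprob, hfst, hsnd, hmart⟩ := StrassenAux.exists_coupling hmom₁ hmom₂ hconv
  have hi1 : Integrable (fun z : StrassenAux.Eu n × StrassenAux.Eu n => z.1) π := by
    rw [← hfst, Measure.fst] at hmom₁
    have h1 := hmom₁.comp_measurable measurable_fst
    exact (integrable_norm_iff measurable_fst.aestronglyMeasurable).1 h1
  have hi2 : Integrable (fun z : StrassenAux.Eu n × StrassenAux.Eu n => z.2) π := by
    rw [← hsnd, Measure.snd] at hmom₂
    have h1 := hmom₂.comp_measurable measurable_snd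
    exact (integrable_norm_iff measurable_snd.aestronglyMeasurable).1 h1
  have hd := hi2.sub hi1
  have hdis : π.fst ⊗ₘ π.condKernel = π := π.disintegrate π.condKernel
  refine ⟨π.condKernel, inferInstance, ?_, ?_⟩
  · have hk := hi2.condKernel_ae
    have hm : Integrable (fun x => ∫ y, (y - x) ∂(π.condKernel x)) μ₁ := by
      rw [← hfst]
      exact hd.integral_condKernel
    have hz := ae_eq_zero_of_integral_contDiff_smul_eq_zero hm.locallyIntegrable (fun h hsm hcs => ?_)
    · rw [hfst] at hk
      filter_upwards [hk, hz] with x hx1 hx2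
      refine ⟨hx1, ?_⟩
      rw [integral_sub hx1 (integrable_const _)] at hx2
      simpa [sub_eq_zero] using hx2
    · have hc := hsm.continuous
      obtain ⟨C, hC⟩ := hc.bounded_above_of_compact_support hcs
      have hint : Integrable (fun z : StrassenAux.Eu n × StrassenAux.Eu n =>
          h z.1 • (z.2 - z.1)) π :=
        hd.bdd_smul C (hc.comp continuous_fst).aestronglyMeasurable
          (Filter.Eventually.of_forall fun z => hC z.1)
      have h1 : ∫ x, h x • ∫ y, (y - x) ∂(π.condKernel x) ∂μ₁ =
          ∫ z : StrassenAux.Eu n × StrassenAux.Eu n, h z.1 • (z.2 - z.1) ∂π := by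
        rw [← hfst, ← Measure.integral_condKernel hint]
        simp only [integral_smul]
      rw [h1]
      refine ext_inner_left ℝ fun c => ?_
      rw [← integral_inner hint, inner_zero_right]
      simp only [inner_smul_right]
      exact hmart h hc ⟨C, hC⟩ c
  · have := Measure.snd_compProd π.fst π.condKernel
    rw [hdis, hsnd, hfst] at this
    exact this.symm
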